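/- The node constraint 𝒩_ℛℛ of ℛ̄(ℛ(Π)) consists exactly of the configurations ⟨⟨ℓ(C)⟩⟩^{Δ−|C|+1} ⟨⟨ℓ(∅)⟩⟩^{|C|−1} for nonempty C ⊆ 𝔠, where ⟨⟨ℓ(C)⟩⟩ = {⟨ℓ(C')⟩ : C ⊆ C' ⊆ 𝔠}. -/

import Mathlib

open scoped Classical

/-- `StrEq 𝒞 B A` : the label `A` is at least as strong as the label `B` according to the
constraint `𝒞` (written `B ≤ A`): every configuration of `𝒞` containing `B` remains a
configuration of `𝒞` after replacing one occurrence of `B` by `A`. -/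
def StrEq {L : Type*} [DecidableEq L] (𝒞 : Set (Multiset L)) (B A : L) : Prop :=
  ∀ m ∈ 𝒞, B ∈ m → (A ::ₘ m.erase B) ∈ 𝒞

/-- `IsChoice m c` : the multiset `c` is obtained by choosing one element from each of the
sets in the configuration `m`. -/
def IsChoice {L : Type*} (m : Multiset (Set L)) (c : Multiset L) : Prop :=
  Multiset.Rel (fun B a => a ∈ B) m c

/-- The hyperedge constraint ℰ_Π: the label `ℓ(C)` is identified with the color set
`C ⊆ 𝔠 = {1, …, Δ}` (here `Finset (Fin Δ)`), and a hyperedge configuration is a multiset of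
`r` labels `ℓ(C₁) … ℓ(C_r)` such that for each color `i` there is at least one index `j`
with `i ∉ C_j`. -/
def EPi (Δ r : ℕ) : Set (Multiset (Finset (Fin Δ))) :=
  {m | Multiset.card m = r ∧ ∀ i : Fin Δ, ∃ C ∈ m, i ∉ C}

/-- The node constraint 𝒩_Π: the configurations `ℓ(C)^{Δ−|C|+1} ℓ(∅)^{|C|−1}` for
nonempty `C ⊆ 𝔠`. -/
def NPi (Δ : ℕ) : Set (Multiset (Finset (Fin Δ))) :=
  {m | ∃ C : Finset (Fin Δ), C ≠ ∅ ∧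
    m = Multiset.replicate (Δ - C.card + 1) C +
        Multiset.replicate (C.card - 1) (∅ : Finset (Fin Δ))}

/-- `⟨ℓ(C)⟩`, the set of all labels at least as strong as `ℓ(C)` according to ℰ_Π. -/
def genE (Δ r : ℕ) (C : Finset (Fin Δ)) : Set (Finset (Fin Δ)) :=
  {A | StrEq (EPi Δ r) C A}

/-- Configurations `B₁ … B_r` of nonempty subsets of Σ_Π all of whose choices form
configurations of ℰ_Π. -/
def ECand (Δ r : ℕ) : Set (Multiset (Set (Finset (Fin Δ)))) :=
  {m | Multiset.card m = r ∧ (∀ B ∈ m, B.Nonempty) ∧ ∀ c, IsChoice m c → c ∈ EPi Δ r}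

/-- The hyperedge constraint ℰ_ℛ of ℛ(Π): the maximal configurations among `ECand`. -/
def ER (Δ r : ℕ) : Set (Multiset (Set (Finset (Fin Δ)))) :=
  {m | m ∈ ECand Δ r ∧ ∀ m' ∈ ECand Δ r, Multiset.Rel (· ⊆ ·) m m' → m = m'}

/-- The label set Σ_ℛ of ℛ(Π): the subsets of Σ_Π occurring in configurations of ℰ_ℛ. -/
def SigR (Δ r : ℕ) : Set (Set (Finset (Fin Δ))) :=
  {B | ∃ m ∈ ER Δ r, B ∈ m}

/-- The node constraint 𝒩_ℛ of ℛ(Π): configurations `B₁ … B_Δ` of labels of Σ_ℛ such that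
some choice forms a configuration of 𝒩_Π. -/
def NR (Δ r : ℕ) : Set (Multiset (Set (Finset (Fin Δ)))) :=
  {m | Multiset.card m = Δ ∧ (∀ B ∈ m, B ∈ SigR Δ r) ∧ ∃ c, IsChoice m c ∧ c ∈ NPi Δ}

/-- `⟨⟨ℓ(C)⟩⟩ = {⟨ℓ(C')⟩ : C ⊆ C' ⊆ 𝔠}`. -/
def gen2 (Δ r : ℕ) (C : Finset (Fin Δ)) : Set (Set (Finset (Fin Δ))) :=
  {B | ∃ C' : Finset (Fin Δ), C ⊆ C' ∧ B = genE Δ r C'}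

/-- Configurations `Q₁ … Q_Δ` of nonempty subsets of Σ_ℛ all of whose choices form
configurations of 𝒩_ℛ. -/
def NCand (Δ r : ℕ) : Set (Multiset (Set (Set (Finset (Fin Δ))))) :=
  {m | Multiset.card m = Δ ∧ (∀ Q ∈ m, Q.Nonempty ∧ Q ⊆ SigR Δ r) ∧
       ∀ c, IsChoice m c → c ∈ NR Δ r}

/-- The node constraint 𝒩_ℛℛ of ℛ̄(ℛ(Π)): the maximal configurations among `NCand`. -/
def NRR (Δ r : ℕ) : Set (Multiset (Set (Set (Finset (Fin Δ))))) :=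
  {m | m ∈ NCand Δ r ∧ ∀ m' ∈ NCand Δ r, Multiset.Rel (· ⊆ ·) m m' → m = m'}

/-- The label set Σ_ℛℛ of ℛ̄(ℛ(Π)): the subsets of Σ_ℛ occurring in 𝒩_ℛℛ. -/
def SigRR (Δ r : ℕ) : Set (Set (Set (Finset (Fin Δ)))) :=
  {Q | ∃ m ∈ NRR Δ r, Q ∈ m}

/-- The hyperedge constraint ℰ_ℛℛ of ℛ̄(ℛ(Π)): configurations `Q₁ … Q_r` of labels of Σ_ℛℛ
such that some choice forms a configuration of ℰ_ℛ. -/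
def ERR (Δ r : ℕ) : Set (Multiset (Set (Set (Finset (Fin Δ))))) :=
  {m | Multiset.card m = r ∧ (∀ Q ∈ m, Q ∈ SigRR Δ r) ∧ ∃ c, IsChoice m c ∧ c ∈ ER Δ r}

theorem rel_fun {α β : Type*} [Nonempty β] (R : α → β → Prop) (s : Multiset α) (hs : s.Nodup)
    (c : Multiset β) (h : Multiset.Rel R s c) :
    ∃ q : α → β, c = s.map q ∧ ∀ a ∈ s, R a (q a) := by
  induction s using Multiset.induction_on generalizing c with
  | empty =>
    rw [Multiset.rel_zero_left] at h
    exact ⟨fun _ => Classical.arbitrary β, by simp [h], by simp⟩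
  | cons a s ih =>
    rw [Multiset.rel_cons_left] at h
    obtain ⟨b, c', hab, hr, rfl⟩ := h
    rw [Multiset.nodup_cons] at hs
    obtain ⟨q, rfl, hq⟩ := ih hs.2 _ hr
    refine ⟨Function.update q a b, ?_, ?_⟩
    · rw [Multiset.map_cons, Function.update_self]
      congr 1
      apply Multiset.map_congr rfl
      intro x hx
      rw [Function.update_of_ne]
      rintro rfl
      exact hs.1 hx
    · intro x hx
      by_cases hxa : x = a
      · subst hxa; simpa using hab
      · rw [Function.update_of_ne hxa]
        exact hq x ((Multiset.mem_cons.1 hx).resolve_left hxa)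

/-- multiset of a tuple -/
def tup {n : ℕ} {α : Type*} (f : Fin n → α) : Multiset α := (Finset.univ : Finset (Fin n)).val.map f

theorem card_tup {n : ℕ} {α : Type*} (f : Fin n → α) : Multiset.card (tup f) = n := by
  simp [tup]

theorem mem_tup {n : ℕ} {α : Type*} (f : Fin n → α) (a : α) : a ∈ tup f ↔ ∃ i, f i = a := by
  simp [tup]

theorem exists_tup {n : ℕ} {α : Type*} (m : Multiset α) (h : Multiset.card m = n) :
    ∃ f : Fin n → α, m = tup f := by
  subst h
  induction m using Quotient.inductionOn with
  | h l =>
    refine ⟨fun i => l.get i, ?_⟩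
    have h := Fin.univ_val_map (fun i : Fin l.length => l.get i)
    rw [List.ofFn_get] at h
    exact h.symm

theorem rel_tup {n : ℕ} {α β : Type*} [Nonempty β] (R : α → β → Prop) (f : Fin n → α)
    (c : Multiset β) : Multiset.Rel R (tup f) c ↔ ∃ q : Fin n → β, c = tup q ∧ ∀ i, R (f i) (q i) := by
  constructor
  · intro h
    rw [tup, Multiset.rel_map_left] at h
    obtain ⟨q, h1, h2⟩ := rel_fun _ _ Finset.univ.nodup _ h
    exact ⟨q, h1, fun i => h2 i (Finset.mem_univ i)⟩
  · rintro ⟨q, rfl, h⟩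
    rw [tup, tup, Multiset.rel_map]
    exact Multiset.rel_refl_of_refl_on (fun i _ => h i)

theorem tup_ite {n : ℕ} {α : Type*} (S : Finset (Fin n)) (a b : α) :
    tup (fun i => if i ∈ S then a else b) =
      Multiset.replicate S.card a + Multiset.replicate (n - S.card) b := by
  have h : (Finset.univ : Finset (Fin n)).val = S.val + Sᶜ.val := by
    have : (Finset.univ : Finset (Fin n)) = S.disjUnion Sᶜ disjoint_compl_right := by
      ext; simp [em]
    rw [this]; rfl
  rw [tup, h, Multiset.map_add]
  congr 1
  · rw [Multiset.map_congr rfl (g := fun _ => a)]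
    · simp
    · intro x hx
      have : x ∈ S := hx
      simp [this]
  · rw [Multiset.map_congr rfl (g := fun _ => b)]
    · simp [Finset.card_compl]
    · intro x hx
      have : x ∈ Sᶜ := hx
      rw [Finset.mem_compl] at this
      simp [this]

theorem tup_EPi {Δ r : ℕ} (q : Fin r → Finset (Fin Δ)) :
    tup q ∈ EPi Δ r ↔ ∀ i, ∃ j, i ∉ q j := by
  simp [EPi, card_tup, mem_tup]

theorem mem_genE {Δ r : ℕ} (hr : 2 ≤ r) (C A : Finset (Fin Δ)) : A ∈ genE Δ r C ↔ A ⊆ C := by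
  constructor
  · intro h i hi
    by_contra hC
    have h1 := h (C ::ₘ Cᶜ ::ₘ Multiset.replicate (r-2) Finset.univ) ?_ (by simp)
    · obtain ⟨D, hD, hiD⟩ := h1.2 i
      rw [Multiset.erase_cons_head] at hD
      simp only [Multiset.mem_cons, Multiset.mem_replicate] at hD
      rcases hD with rfl | rfl | ⟨_, rfl⟩
      · exact hiD hi
      · simp [hC] at hiD
      · simp at hiD
    · refine ⟨by simp; omega, fun k => ?_⟩
      by_cases hk : k ∈ C
      · exact ⟨Cᶜ, by simp, by simpa using hk⟩
      · exact ⟨C, by simp, hk⟩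
  · intro h m hm hC
    refine ⟨?_, fun i => ?_⟩
    · rw [Multiset.card_cons, Multiset.card_erase_add_one hC]; exact hm.1
    · obtain ⟨D, hD, hi⟩ := hm.2 i
      by_cases hDC : D = C
      · subst hDC
        exact ⟨A, by simp, fun hA => hi (h hA)⟩
      · exact ⟨D, Multiset.mem_cons_of_mem ((Multiset.mem_erase_of_ne hDC).2 hD), hi⟩

theorem tup_ECand {Δ r : ℕ} (B : Fin r → Set (Finset (Fin Δ))) :
    tup B ∈ ECand Δ r ↔ (∀ j, (B j).Nonempty) ∧
      ∀ q : Fin r → Finset (Fin Δ), (∀ j, q j ∈ B j) → ∀ i, ∃ j, i ∉ q j := by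
  constructor
  · rintro ⟨_, h1, h2⟩
    refine ⟨fun j => h1 _ ((mem_tup _ _).2 ⟨j, rfl⟩), fun q hq => ?_⟩
    rw [← tup_EPi]
    exact h2 _ ((rel_tup _ _ _).2 ⟨q, rfl, hq⟩)
  · rintro ⟨h1, h2⟩
    refine ⟨card_tup _, ?_, ?_⟩
    · intro X hX
      obtain ⟨j, rfl⟩ := (mem_tup _ _).1 hX
      exact h1 j
    · intro c hc
      obtain ⟨q, rfl, hq⟩ := (rel_tup _ _ _).1 hc
      rw [tup_EPi]
      exact h2 q hq

theorem mem_SigR {Δ r : ℕ} (hr : 2 ≤ r) (X : Set (Finset (Fin Δ))) :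
    X ∈ SigR Δ r ↔ ∃ C, X = genE Δ r C := by
  constructor
  · rintro ⟨m, ⟨hm, hmax⟩, hX⟩
    obtain ⟨B, rfl⟩ := exists_tup m hm.1
    rw [tup_ECand] at hm
    let U : Fin r → Finset (Fin Δ) := fun j => Finset.univ.filter (fun i => ∃ A ∈ B j, i ∈ A)
    have key := hmax (tup (fun j => genE Δ r (U j))) ?_ ?_
    · rw [key] at hX
      obtain ⟨j, rfl⟩ := (mem_tup _ _).1 hX
      exact ⟨_, rfl⟩
    · rw [tup_ECand]
      refine ⟨fun j => ⟨∅, (mem_genE hr _ _).2 (by simp)⟩, fun q hq i => ?_⟩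
      by_contra hcon
      push Not at hcon
      have : ∀ j, ∃ A ∈ B j, i ∈ A := fun j => by
        have := (mem_genE hr _ _).1 (hq j) (hcon j)
        simpa [U] using this
      choose p hp hip using this
      obtain ⟨j, hj⟩ := hm.2 p hp i
      exact hj (hip j)
    · rw [rel_tup]
      refine ⟨_, rfl, fun j A hA => (mem_genE hr _ _).2 fun i hi => ?_⟩
      simp only [U, Finset.mem_filter, Finset.mem_univ, true_and]
      exact ⟨A, hA, hi⟩
  · rintro ⟨C, rfl⟩
    let D : Fin r → Finset (Fin Δ) := fun k =>
      if k.1 = 0 then C else if k.1 = 1 then Cᶜ else Finset.univ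
    refine ⟨tup (fun k => genE Δ r (D k)), ⟨?_, ?_⟩, (mem_tup _ _).2 ⟨⟨0, by omega⟩, by simp [D]⟩⟩
    · rw [tup_ECand]
      refine ⟨fun j => ⟨∅, (mem_genE hr _ _).2 (by simp)⟩, fun q hq i => ?_⟩
      by_cases hi : i ∈ C
      · refine ⟨⟨1, by omega⟩, fun h => ?_⟩
        have := (mem_genE hr _ _).1 (hq _) h
        simp [D, hi] at this
      · refine ⟨⟨0, by omega⟩, fun h => ?_⟩
        have := (mem_genE hr _ _).1 (hq _) h
        simp [D, hi] at this
    · intro m' hm' hrel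
      obtain ⟨B', rfl, hB⟩ := (rel_tup _ _ _).1 hrel
      rw [tup_ECand] at hm'
      congr 1
      funext j
      refine Set.Subset.antisymm (hB j) fun A hA => (mem_genE hr _ _).2 fun i hi => ?_
      by_contra hij
      obtain ⟨k, hk⟩ := hm'.2 (Function.update D j A) (fun k => by
        by_cases hkj : k = j
        · subst hkj; simpa using hA
        · rw [Function.update_of_ne hkj]
          exact hB k ((mem_genE hr _ _).2 subset_rfl)) i
      by_cases hkj : k = j
      · subst hkj; simp [hi] at hk
      · rw [Function.update_of_ne hkj] at hk
        have hkj' : k.1 ≠ j.1 := fun h => hkj (Fin.ext h)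
        simp only [D] at hk hij
        split_ifs at hk hij <;> simp_all

theorem tup_NR {Δ r : ℕ} (hr : 2 ≤ r) (C : Fin Δ → Finset (Fin Δ)) :
    tup (fun i => genE Δ r (C i)) ∈ NR Δ r ↔ ∃ D : Finset (Fin Δ), D ≠ ∅ ∧
      Δ - D.card + 1 ≤ (Finset.univ.filter (fun i => D ⊆ C i)).card := by
  constructor
  · rintro ⟨_, _, c, hc, D, hD, hcD⟩
    obtain ⟨q, rfl, hq⟩ := (rel_tup _ _ _).1 hc
    refine ⟨D, hD, ?_⟩
    have h1 : Δ - D.card + 1 ≤ Multiset.count D (tup q) := by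
      rw [hcD, Multiset.count_add, Multiset.count_replicate_self]; omega
    refine h1.trans ?_
    rw [tup, Multiset.count_map]
    change (Finset.univ.filter (fun i => D = q i)).card ≤ _
    apply Finset.card_le_card
    intro i
    simp only [Finset.mem_filter, Finset.mem_univ, true_and]
    intro h
    rw [h]
    exact (mem_genE hr _ _).1 (hq i)
  · rintro ⟨D, hD, h⟩
    obtain ⟨S, hS, hcard⟩ := Finset.exists_subset_card_eq h
    refine ⟨card_tup _, ?_, tup (fun i => if i ∈ S then D else ∅), ?_, D, hD, ?_⟩
    · intro X hX
      obtain ⟨j, rfl⟩ := (mem_tup _ _).1 hX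
      exact (mem_SigR hr _).2 ⟨_, rfl⟩
    · refine (rel_tup _ _ _).2 ⟨_, rfl, fun i => (mem_genE hr _ _).2 ?_⟩
      split_ifs with hi
      · simpa using hS hi
      · simp
    · rw [tup_ite, hcard]
      have := Finset.card_pos.2 (Finset.nonempty_iff_ne_empty.2 hD)
      have h2 := Finset.card_le_univ D
      rw [Fintype.card_fin] at h2
      congr 2
      omega

theorem mem_gen2 {Δ r : ℕ} (hr : 2 ≤ r) (C D : Finset (Fin Δ)) :
    genE Δ r D ∈ gen2 Δ r C ↔ C ⊆ D := by
  constructor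
  · rintro ⟨C', h, h'⟩
    have : D ∈ genE Δ r C' := by rw [← h']; exact (mem_genE hr _ _).2 subset_rfl
    have h2 : C' ∈ genE Δ r D := by rw [h']; exact (mem_genE hr _ _).2 subset_rfl
    exact h.trans ((mem_genE hr _ _).1 h2)
  · intro h
    exact ⟨D, h, rfl⟩

theorem tup_NCand {Δ r : ℕ} (hr : 2 ≤ r) (Q : Fin Δ → Set (Set (Finset (Fin Δ)))) :
    tup Q ∈ NCand Δ r ↔ (∀ j, (Q j).Nonempty ∧ Q j ⊆ SigR Δ r) ∧
      ∀ C : Fin Δ → Finset (Fin Δ), (∀ j, genE Δ r (C j) ∈ Q j) → ∃ D : Finset (Fin Δ), D ≠ ∅ ∧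
      Δ - D.card + 1 ≤ (Finset.univ.filter (fun i => D ⊆ C i)).card := by
  constructor
  · rintro ⟨_, h1, h2⟩
    refine ⟨fun j => h1 _ ((mem_tup _ _).2 ⟨j, rfl⟩), fun q hq => ?_⟩
    rw [← tup_NR hr]
    exact h2 _ ((rel_tup _ _ _).2 ⟨_, rfl, hq⟩)
  · rintro ⟨h1, h2⟩
    refine ⟨card_tup _, ?_, ?_⟩
    · intro X hX
      obtain ⟨j, rfl⟩ := (mem_tup _ _).1 hX
      exact h1 j
    · intro c hc
      obtain ⟨q, rfl, hq⟩ := (rel_tup _ _ _).1 hc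
      have : ∀ j, ∃ C, q j = genE Δ r C := fun j => (mem_SigR hr _).1 ((h1 j).2 (hq j))
      choose C hC using this
      obtain rfl : q = fun j => genE Δ r (C j) := funext hC
      rw [tup_NR hr]
      exact h2 C hq

/-- Hall step -/
theorem NCand_dom {Δ r : ℕ} (hr : 2 ≤ r) (Q : Fin Δ → Set (Set (Finset (Fin Δ))))
    (h : tup Q ∈ NCand Δ r) : ∃ D : Finset (Fin Δ), D ≠ ∅ ∧
      Δ - D.card + 1 ≤ (Finset.univ.filter (fun i => Q i ⊆ gen2 Δ r D)).card := by
  rw [tup_NCand hr] at h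
  obtain ⟨h1, h2⟩ := h
  by_contra hcon
  push Not at hcon
  let t : Fin Δ → Finset (Fin Δ) := fun c =>
    Finset.univ.filter (fun i => ∃ A : Finset (Fin Δ), genE Δ r A ∈ Q i ∧ c ∉ A)
  have hall : ∀ s : Finset (Fin Δ), s.card ≤ (s.biUnion t).card := by
    intro s
    by_cases hs : s = ∅
    · simp [hs]
    have h3 := hcon s (Finset.nonempty_iff_ne_empty.2 hs)
    have h4 : (s.biUnion t)ᶜ ⊆ Finset.univ.filter (fun i => Q i ⊆ gen2 Δ r s) := by
      intro i hi
      simp only [Finset.mem_compl, Finset.mem_biUnion, t, Finset.mem_filter, Finset.mem_univ,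
        true_and, not_exists, not_and, not_not] at hi ⊢
      intro X hX
      obtain ⟨A, rfl⟩ := (mem_SigR hr _).1 ((h1 i).2 hX)
      exact (mem_gen2 hr _ _).2 fun c hc => hi c hc A hX
    have h5 := Finset.card_le_card h4
    rw [Finset.card_compl, Fintype.card_fin] at h5
    have h6 := Finset.card_le_univ s
    rw [Fintype.card_fin] at h6
    omega
  obtain ⟨f, hf, hft⟩ := (Finset.all_card_le_biUnion_card_iff_exists_injective t).1 hall
  have hsurj : Function.Bijective f := Finite.injective_iff_bijective.1 hf
  have : ∀ i, ∃ A : Finset (Fin Δ), genE Δ r A ∈ Q i ∧ ∀ c, f c = i → c ∉ A := by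
    intro i
    obtain ⟨c, rfl⟩ := hsurj.2 i
    have := hft c
    simp only [t, Finset.mem_filter, Finset.mem_univ, true_and] at this
    obtain ⟨A, hA, hc⟩ := this
    refine ⟨A, hA, fun c' hc' => ?_⟩
    rw [hf hc']; exact hc
  choose A hA hcA using this
  obtain ⟨D, hD, hle⟩ := h2 A hA
  have h7 : Finset.univ.filter (fun i => D ⊆ A i) ⊆ (D.image f)ᶜ := by
    intro i hi
    simp only [Finset.mem_filter, Finset.mem_univ, true_and, Finset.mem_compl,
      Finset.mem_image, not_exists, not_and] at hi ⊢
    intro c hc hci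
    exact hcA i c hci (hi hc)
  have h8 := Finset.card_le_card h7
  rw [Finset.card_compl, Fintype.card_fin, Finset.card_image_of_injective _ hf] at h8
  omega

theorem gen2_sub_SigR {Δ r : ℕ} (hr : 2 ≤ r) (C : Finset (Fin Δ)) : gen2 Δ r C ⊆ SigR Δ r := by
  rintro X ⟨D, _, rfl⟩
  exact (mem_SigR hr _).2 ⟨D, rfl⟩

theorem SigR_sub {Δ r : ℕ} (hr : 2 ≤ r) : SigR Δ r ⊆ gen2 Δ r ∅ := by
  intro X hX
  obtain ⟨D, rfl⟩ := (mem_SigR hr _).1 hX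
  exact ⟨D, by simp, rfl⟩

theorem conf_eq {Δ r : ℕ} (C S : Finset (Fin Δ)) (hC : C ≠ ∅) (hS : S.card = Δ - C.card + 1) :
    tup (fun i => if i ∈ S then gen2 Δ r C else gen2 Δ r ∅) =
      Multiset.replicate (Δ - C.card + 1) (gen2 Δ r C) +
          Multiset.replicate (C.card - 1) (gen2 Δ r ∅) := by
  rw [tup_ite, hS]
  have := Finset.card_pos.2 (Finset.nonempty_iff_ne_empty.2 hC)
  have h2 := Finset.card_le_univ C
  rw [Fintype.card_fin] at h2
  congr 2
  omega

theorem conf_cand {Δ r : ℕ} (hr : 2 ≤ r) (C S : Finset (Fin Δ)) (hC : C ≠ ∅)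
    (hS : S.card = Δ - C.card + 1) :
    tup (fun i => if i ∈ S then gen2 Δ r C else gen2 Δ r ∅) ∈ NCand Δ r := by
  rw [tup_NCand hr]
  refine ⟨fun j => ?_, fun A hA => ⟨C, hC, ?_⟩⟩
  · split_ifs
    · exact ⟨⟨_, C, subset_rfl, rfl⟩, gen2_sub_SigR hr _⟩
    · exact ⟨⟨_, ∅, subset_rfl, rfl⟩, gen2_sub_SigR hr _⟩
  · rw [← hS]
    apply Finset.card_le_card
    intro i hi
    have := hA i
    rw [if_pos hi, mem_gen2 hr] at this
    simpa using this

/-- The node constraint 𝒩_ℛℛ of ℛ̄(ℛ(Π)) consists exactly of the configurations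
`⟨⟨ℓ(C)⟩⟩^{Δ−|C|+1} ⟨⟨ℓ(∅)⟩⟩^{|C|−1}` for nonempty `C ⊆ 𝔠`. -/
theorem stmt_5 (Δ r : ℕ) (hΔ : 2 ≤ Δ) (hr : 2 ≤ r) :
    NRR Δ r = {m | ∃ C : Finset (Fin Δ), C ≠ ∅ ∧
      m = Multiset.replicate (Δ - C.card + 1) (gen2 Δ r C) +
          Multiset.replicate (C.card - 1) (gen2 Δ r ∅)} := by
  ext m
  constructor
  · rintro ⟨hm, hmax⟩
    obtain ⟨Q, rfl⟩ := exists_tup m hm.1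
    obtain ⟨C, hC, hle⟩ := NCand_dom hr Q hm
    obtain ⟨S, hS, hcard⟩ := Finset.exists_subset_card_eq hle
    refine ⟨C, hC, ?_⟩
    rw [← conf_eq C S hC hcard]
    apply hmax _ (conf_cand hr C S hC hcard)
    refine (rel_tup _ _ _).2 ⟨_, rfl, fun i => ?_⟩
    split_ifs with hi
    · simpa using hS hi
    · exact (((tup_NCand hr _).1 hm).1 i).2.trans (SigR_sub hr)
  · rintro ⟨C, hC, rfl⟩
    have hC0 := Finset.card_pos.2 (Finset.nonempty_iff_ne_empty.2 hC)
    have hC1 := Finset.card_le_univ C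
    rw [Fintype.card_fin] at hC1
    obtain ⟨S, -, hS⟩ := Finset.exists_subset_card_eq (s := (Finset.univ : Finset (Fin Δ)))
      (n := Δ - C.card + 1) (by rw [Finset.card_univ, Fintype.card_fin]; omega)
    rw [← conf_eq C S hC hS]
    refine ⟨conf_cand hr C S hC hS, fun m' hm' hrel => ?_⟩
    obtain ⟨Q, rfl, hQ⟩ := (rel_tup _ _ _).1 hrel
    obtain ⟨D, hD, hle⟩ := NCand_dom hr Q hm'
    have hD1 := Finset.card_le_univ D
    rw [Fintype.card_fin] at hD1
    set T := Finset.univ.filter (fun i => Q i ⊆ gen2 Δ r D) with hT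
    have key : ∀ i ∈ T, i ∈ S ∧ D ⊆ C := by
      intro i hi
      have h1 : Q i ⊆ gen2 Δ r D := by simpa [hT] using hi
      have h2 := (hQ i).trans h1
      by_cases hiS : i ∈ S
      · rw [if_pos hiS] at h2
        exact ⟨hiS, (mem_gen2 hr _ _).1 (h2 ((mem_gen2 hr _ _).2 subset_rfl))⟩
      · rw [if_neg hiS] at h2
        exact absurd (Finset.subset_empty.1
          ((mem_gen2 hr _ _).1 (h2 ((mem_gen2 hr _ _).2 subset_rfl)))) hD
    obtain ⟨i0, hi0⟩ : T.Nonempty := Finset.card_pos.1 (by omega)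
    have hDC := (key i0 hi0).2
    have hTS : T ⊆ S := fun i hi => (key i hi).1
    have h3 := Finset.card_le_card hTS
    obtain rfl : D = C := Finset.eq_of_subset_of_card_le hDC (by omega)
    have hTS' : T = S := Finset.eq_of_subset_of_card_le hTS (by omega)
    congr 1
    funext i
    apply Set.Subset.antisymm (hQ i)
    split_ifs with hi
    · rw [← hTS'] at hi
      simpa [hT] using hi
    · exact (((tup_NCand hr _).1 hm').1 i).2.trans (SigR_sub hr)
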